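/- arXiv:1305.3903 — 2 statements merged into one kernel-verified Lean document; each statement's English description precedes it below -/
import Mathlib

section
/- Let X and Y be 3×3 upper triangular tropical matrices that are diagonally equivalent (Xᵢᵢ = Yᵢᵢ for i = 1,2,3). Then, setting M = Y·X·X·Y·Y·X (the evaluation of the word yx²y²x), one has M·X·M = M·Y·M. -/
/-- The max-plus tropical semiring `𝕋 = ℝ ∪ {-∞}`, realized as `Tropical (WithTop ℝᵒᵈ)`:
tropical addition is `max`, tropical multiplication is `+`, and `⊤` corresponds to `-∞`. -/
abbrev Trop : Type := Tropical (WithTop ℝᵒᵈ)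

noncomputable def mon (a b c : Trop) (e : ℕ × ℕ × ℕ) : Trop := a ^ e.1 * b ^ e.2.1 * c ^ e.2.2

noncomputable def poly (a b c : Trop) (L : List (ℕ × ℕ × ℕ)) : Trop := (L.map (mon a b c)).sum

lemma poly_le (a b c : Trop) {L : List (ℕ × ℕ × ℕ)} {e : ℕ × ℕ × ℕ} (h : e ∈ L) :
    poly a b c L ≤ mon a b c e := by
  induction L with
  | nil => simp at h
  | cons x L ih =>
    have h1 : poly a b c (x :: L) = mon a b c x + poly a b c L := by simp [poly]
    rw [h1]
    rw [← Tropical.untrop_le_iff, Tropical.untrop_add]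
    rcases List.mem_cons.1 h with rfl | h
    · exact min_le_left _ _
    · exact (min_le_right _ _).trans (Tropical.untrop_le_iff.2 (ih h))

lemma pow_cancel {n : ℕ} (hn : n ≠ 0) {x y : Trop} (h : x ^ n ≤ y ^ n) : x ≤ y := by
  rw [← Tropical.untrop_le_iff] at h ⊢
  rw [Tropical.untrop_pow, Tropical.untrop_pow] at h
  generalize Tropical.untrop x = u at *
  generalize Tropical.untrop y = v at *
  induction v using WithTop.recTopCoe with
  | top => exact le_top
  | coe v =>
    induction u using WithTop.recTopCoe with
    | top =>
      exfalso
      rw [← WithTop.coe_nsmul] at h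
      have h2 : n • (⊤ : WithTop ℝᵒᵈ) = ⊤ := by
        obtain ⟨m, rfl⟩ := Nat.exists_eq_succ_of_ne_zero hn
        rw [Nat.succ_eq_add_one, succ_nsmul, WithTop.add_top]
      rw [h2] at h
      exact absurd h (not_le.2 (WithTop.coe_lt_top _))
    | coe u =>
      rw [← WithTop.coe_nsmul, ← WithTop.coe_nsmul, WithTop.coe_le_coe] at h
      exact WithTop.coe_le_coe.2 ((nsmul_le_nsmul_iff_right hn).1 h)

lemma dom {a b c : Trop} {L : List (ℕ × ℕ × ℕ)} {e e₁ e₂ e₃ : ℕ × ℕ × ℕ} {n i j k : ℕ}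
    (h₁ : e₁ ∈ L) (h₂ : e₂ ∈ L) (h₃ : e₃ ∈ L) (hn : n ≠ 0) (hs : i + j + k = n)
    (ha : e.1 * n = e₁.1 * i + e₂.1 * j + e₃.1 * k)
    (hb : e.2.1 * n = e₁.2.1 * i + e₂.2.1 * j + e₃.2.1 * k)
    (hc : e.2.2 * n = e₁.2.2 * i + e₂.2.2 * j + e₃.2.2 * k) :
    poly a b c L ≤ mon a b c e := by
  apply pow_cancel hn
  have : mon a b c e ^ n = mon a b c e₁ ^ i * mon a b c e₂ ^ j * mon a b c e₃ ^ k := by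
    simp only [mon, mul_pow, ← pow_mul, ha, hb, hc]
    simp only [pow_add]
    ac_rfl
  rw [this, ← hs, pow_add, pow_add]
  exact mul_le_mul' (mul_le_mul' (pow_le_pow_left' (poly_le a b c h₁) i)
    (pow_le_pow_left' (poly_le a b c h₂) j)) (pow_le_pow_left' (poly_le a b c h₃) k)

lemma absorb {a b c : Trop} {L C : List (ℕ × ℕ × ℕ)} 
    (h : ∀ e ∈ C, poly a b c L ≤ mon a b c e) : poly a b c L + poly a b c C = poly a b c L := by
  induction C with
  | nil => simp [poly]
  | cons x C ih =>
    have h1 : poly a b c (x :: C) = mon a b c x + poly a b c C := by simp [poly]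
    rw [h1, ← add_assoc, Tropical.add_eq_left (h x (by simp)), ih (fun e he => h e (by simp [he]))]

lemma d_x_xx (a b c : Trop) : poly a b c [(1,0,10), (1,3,7), (1,6,4), (1,7,3), (1,10,0), (2,2,7), (2,5,4), (2,6,3), (2,9,0), (5,2,4), (5,3,3), (5,6,0), (8,0,3), (8,3,0), (9,2,0)] + poly a b c [(1,4,6), (2,3,6), (5,0,6), (6,1,4), (6,2,3), (6,5,0)] = poly a b c [(1,0,10), (1,3,7), (1,6,4), (1,7,3), (1,10,0), (2,2,7), (2,5,4), (2,6,3), (2,9,0), (5,2,4), (5,3,3), (5,6,0), (8,0,3), (8,3,0), (9,2,0)] := by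
  apply absorb
  intro e he
  simp only [List.mem_cons, List.not_mem_nil, or_false] at he
  rcases he with rfl | rfl | rfl | rfl | rfl | rfl
  · exact dom (n := 3) (i := 0) (j := 2) (k := 1) (e₁ := (1,0,10)) (e₂ := (1,3,7)) (e₃ := (1,6,4)) (by simp) (by simp) (by simp) (by norm_num) (by norm_num) (by norm_num) (by norm_num) (by norm_num)
  · exact dom (n := 3) (i := 0) (j := 2) (k := 1) (e₁ := (1,0,10)) (e₂ := (2,2,7)) (e₃ := (2,5,4)) (by simp) (by simp) (by simp) (by norm_num) (by norm_num) (by norm_num) (by norm_num) (by norm_num)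
  · exact dom (n := 7) (i := 3) (j := 0) (k := 4) (e₁ := (1,0,10)) (e₂ := (1,3,7)) (e₃ := (8,0,3)) (by simp) (by simp) (by simp) (by norm_num) (by norm_num) (by norm_num) (by norm_num) (by norm_num)
  · exact dom (n := 5) (i := 1) (j := 1) (k := 3) (e₁ := (1,3,7)) (e₂ := (5,2,4)) (e₃ := (8,0,3)) (by simp) (by simp) (by simp) (by norm_num) (by norm_num) (by norm_num) (by norm_num) (by norm_num)
  · exact dom (n := 3) (i := 0) (j := 1) (k := 2) (e₁ := (1,0,10)) (e₂ := (2,6,3)) (e₃ := (8,0,3)) (by simp) (by simp) (by simp) (by norm_num) (by norm_num) (by norm_num) (by norm_num) (by norm_num)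
  · exact dom (n := 3) (i := 0) (j := 1) (k := 2) (e₁ := (1,0,10)) (e₂ := (2,9,0)) (e₃ := (8,3,0)) (by simp) (by simp) (by simp) (by norm_num) (by norm_num) (by norm_num) (by norm_num) (by norm_num)

lemma d_x_xy (a b c : Trop) : poly a b c [(1,1,9), (1,2,8), (1,5,5), (1,8,2), (1,9,1), (2,0,9), (2,1,8), (2,4,5), (2,7,2), (2,8,1), (5,1,5), (5,4,2), (5,5,1), (8,1,2), (8,2,1), (9,0,2), (9,1,1)] + poly a b c [(6,0,5), (6,3,2), (6,4,1)] = poly a b c [(1,1,9), (1,2,8), (1,5,5), (1,8,2), (1,9,1), (2,0,9), (2,1,8), (2,4,5), (2,7,2), (2,8,1), (5,1,5), (5,4,2), (5,5,1), (8,1,2), (8,2,1), (9,0,2), (9,1,1)] := by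
  apply absorb
  intro e he
  simp only [List.mem_cons, List.not_mem_nil, or_false] at he
  rcases he with rfl | rfl | rfl
  · exact dom (n := 7) (i := 0) (j := 3) (k := 4) (e₁ := (1,1,9)) (e₂ := (2,0,9)) (e₃ := (9,0,2)) (by simp) (by simp) (by simp) (by norm_num) (by norm_num) (by norm_num) (by norm_num) (by norm_num)
  · exact dom (n := 3) (i := 0) (j := 1) (k := 2) (e₁ := (1,1,9)) (e₂ := (2,7,2)) (e₃ := (8,1,2)) (by simp) (by simp) (by simp) (by norm_num) (by norm_num) (by norm_num) (by norm_num) (by norm_num)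
  · exact dom (n := 3) (i := 0) (j := 1) (k := 2) (e₁ := (1,1,9)) (e₂ := (2,8,1)) (e₃ := (8,2,1)) (by simp) (by simp) (by simp) (by norm_num) (by norm_num) (by norm_num) (by norm_num) (by norm_num)

lemma d_x_yx (a b c : Trop) : poly a b c [(0,0,11), (0,1,10), (0,4,7), (0,7,4), (0,8,3), (0,11,0), (3,1,7), (3,4,4), (3,5,3), (3,8,0), (4,0,7), (4,3,4), (4,4,3), (4,7,0), (7,0,4), (7,1,3), (7,4,0), (10,1,0), (11,0,0)] + poly a b c [(0,5,6), (3,2,6), (4,1,6)] = poly a b c [(0,0,11), (0,1,10), (0,4,7), (0,7,4), (0,8,3), (0,11,0), (3,1,7), (3,4,4), (3,5,3), (3,8,0), (4,0,7), (4,3,4), (4,4,3), (4,7,0), (7,0,4), (7,1,3), (7,4,0), (10,1,0), (11,0,0)] := by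
  apply absorb
  intro e he
  simp only [List.mem_cons, List.not_mem_nil, or_false] at he
  rcases he with rfl | rfl | rfl
  · exact dom (n := 3) (i := 0) (j := 1) (k := 2) (e₁ := (0,0,11)) (e₂ := (0,1,10)) (e₃ := (0,7,4)) (by simp) (by simp) (by simp) (by norm_num) (by norm_num) (by norm_num) (by norm_num) (by norm_num)
  · exact dom (n := 3) (i := 0) (j := 2) (k := 1) (e₁ := (0,0,11)) (e₂ := (3,1,7)) (e₃ := (3,4,4)) (by simp) (by simp) (by simp) (by norm_num) (by norm_num) (by norm_num) (by norm_num) (by norm_num)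
  · exact dom (n := 3) (i := 0) (j := 2) (k := 1) (e₁ := (0,0,11)) (e₂ := (4,0,7)) (e₃ := (4,3,4)) (by simp) (by simp) (by simp) (by norm_num) (by norm_num) (by norm_num) (by norm_num) (by norm_num)

lemma d_x (a b c : Trop) : poly a b c [(1,0,11), (2,0,10), (5,0,7), (8,0,4), (9,0,3), (12,0,0)] + poly a b c [(6,0,6)] = poly a b c [(1,0,11), (2,0,10), (5,0,7), (8,0,4), (9,0,3), (12,0,0)] := by
  apply absorb
  intro e he
  simp only [List.mem_cons, List.not_mem_nil, or_false] at he
  rcases he with rfl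
  · exact dom (n := 3) (i := 0) (j := 1) (k := 2) (e₁ := (1,0,11)) (e₂ := (2,0,10)) (e₃ := (8,0,4)) (by simp) (by simp) (by simp) (by norm_num) (by norm_num) (by norm_num) (by norm_num) (by norm_num)

lemma d_y_xy (a b c : Trop) : poly a b c [(1,1,9), (1,2,8), (1,5,5), (1,8,2), (1,9,1), (2,0,9), (2,1,8), (2,4,5), (2,7,2), (2,8,1), (5,1,5), (5,4,2), (5,5,1), (8,1,2), (8,2,1), (9,0,2), (9,1,1)] + poly a b c [(1,4,6), (2,3,6), (5,0,6)] = poly a b c [(1,1,9), (1,2,8), (1,5,5), (1,8,2), (1,9,1), (2,0,9), (2,1,8), (2,4,5), (2,7,2), (2,8,1), (5,1,5), (5,4,2), (5,5,1), (8,1,2), (8,2,1), (9,0,2), (9,1,1)] := by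
  apply absorb
  intro e he
  simp only [List.mem_cons, List.not_mem_nil, or_false] at he
  rcases he with rfl | rfl | rfl
  · exact dom (n := 3) (i := 0) (j := 1) (k := 2) (e₁ := (1,1,9)) (e₂ := (1,2,8)) (e₃ := (1,5,5)) (by simp) (by simp) (by simp) (by norm_num) (by norm_num) (by norm_num) (by norm_num) (by norm_num)
  · exact dom (n := 3) (i := 0) (j := 1) (k := 2) (e₁ := (1,1,9)) (e₂ := (2,1,8)) (e₃ := (2,4,5)) (by simp) (by simp) (by simp) (by norm_num) (by norm_num) (by norm_num) (by norm_num) (by norm_num)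
  · exact dom (n := 7) (i := 0) (j := 4) (k := 3) (e₁ := (1,1,9)) (e₂ := (2,0,9)) (e₃ := (9,0,2)) (by simp) (by simp) (by simp) (by norm_num) (by norm_num) (by norm_num) (by norm_num) (by norm_num)

lemma d_y_yx (a b c : Trop) : poly a b c [(0,0,11), (0,1,10), (0,4,7), (0,7,4), (0,8,3), (0,11,0), (3,1,7), (3,4,4), (3,5,3), (3,8,0), (4,0,7), (4,3,4), (4,4,3), (4,7,0), (7,0,4), (7,1,3), (7,4,0), (10,1,0), (11,0,0)] + poly a b c [(6,1,4), (6,2,3), (6,5,0)] = poly a b c [(0,0,11), (0,1,10), (0,4,7), (0,7,4), (0,8,3), (0,11,0), (3,1,7), (3,4,4), (3,5,3), (3,8,0), (4,0,7), (4,3,4), (4,4,3), (4,7,0), (7,0,4), (7,1,3), (7,4,0), (10,1,0), (11,0,0)] := by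
  apply absorb
  intro e he
  simp only [List.mem_cons, List.not_mem_nil, or_false] at he
  rcases he with rfl | rfl | rfl
  · exact dom (n := 3) (i := 0) (j := 1) (k := 2) (e₁ := (0,0,11)) (e₂ := (4,3,4)) (e₃ := (7,0,4)) (by simp) (by simp) (by simp) (by norm_num) (by norm_num) (by norm_num) (by norm_num) (by norm_num)
  · exact dom (n := 3) (i := 0) (j := 1) (k := 2) (e₁ := (0,0,11)) (e₂ := (4,4,3)) (e₃ := (7,1,3)) (by simp) (by simp) (by simp) (by norm_num) (by norm_num) (by norm_num) (by norm_num) (by norm_num)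
  · exact dom (n := 3) (i := 0) (j := 1) (k := 2) (e₁ := (0,0,11)) (e₂ := (4,7,0)) (e₃ := (7,4,0)) (by simp) (by simp) (by simp) (by norm_num) (by norm_num) (by norm_num) (by norm_num) (by norm_num)

lemma d_y_yy (a b c : Trop) : poly a b c [(0,2,9), (0,3,8), (0,6,5), (0,9,2), (0,10,1), (3,0,8), (3,3,5), (3,6,2), (3,7,1), (4,2,5), (4,5,2), (4,6,1), (7,2,2), (7,3,1), (10,0,1)] + poly a b c [(0,5,6), (3,2,6), (4,1,6), (6,0,5), (6,3,2), (6,4,1)] = poly a b c [(0,2,9), (0,3,8), (0,6,5), (0,9,2), (0,10,1), (3,0,8), (3,3,5), (3,6,2), (3,7,1), (4,2,5), (4,5,2), (4,6,1), (7,2,2), (7,3,1), (10,0,1)] := by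
  apply absorb
  intro e he
  simp only [List.mem_cons, List.not_mem_nil, or_false] at he
  rcases he with rfl | rfl | rfl | rfl | rfl | rfl
  · exact dom (n := 3) (i := 0) (j := 1) (k := 2) (e₁ := (0,2,9)) (e₂ := (0,3,8)) (e₃ := (0,6,5)) (by simp) (by simp) (by simp) (by norm_num) (by norm_num) (by norm_num) (by norm_num) (by norm_num)
  · exact dom (n := 3) (i := 0) (j := 1) (k := 2) (e₁ := (0,2,9)) (e₂ := (3,0,8)) (e₃ := (3,3,5)) (by simp) (by simp) (by simp) (by norm_num) (by norm_num) (by norm_num) (by norm_num) (by norm_num)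
  · exact dom (n := 5) (i := 3) (j := 1) (k := 1) (e₁ := (3,0,8)) (e₂ := (4,2,5)) (e₃ := (7,3,1)) (by simp) (by simp) (by simp) (by norm_num) (by norm_num) (by norm_num) (by norm_num) (by norm_num)
  · exact dom (n := 7) (i := 0) (j := 4) (k := 3) (e₁ := (0,2,9)) (e₂ := (3,0,8)) (e₃ := (10,0,1)) (by simp) (by simp) (by simp) (by norm_num) (by norm_num) (by norm_num) (by norm_num) (by norm_num)
  · exact dom (n := 3) (i := 0) (j := 1) (k := 2) (e₁ := (0,2,9)) (e₂ := (4,5,2)) (e₃ := (7,2,2)) (by simp) (by simp) (by simp) (by norm_num) (by norm_num) (by norm_num) (by norm_num) (by norm_num)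
  · exact dom (n := 3) (i := 0) (j := 1) (k := 2) (e₁ := (0,2,9)) (e₂ := (4,6,1)) (e₃ := (7,3,1)) (by simp) (by simp) (by simp) (by norm_num) (by norm_num) (by norm_num) (by norm_num) (by norm_num)

lemma d_y (a b c : Trop) : poly a b c [(0,0,12), (3,0,9), (4,0,8), (7,0,5), (10,0,2), (11,0,1)] + poly a b c [(6,0,6)] = poly a b c [(0,0,12), (3,0,9), (4,0,8), (7,0,5), (10,0,2), (11,0,1)] := by
  apply absorb
  intro e he
  simp only [List.mem_cons, List.not_mem_nil, or_false] at he
  rcases he with rfl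
  · exact dom (n := 3) (i := 0) (j := 1) (k := 2) (e₁ := (0,0,12)) (e₂ := (4,0,8)) (e₃ := (7,0,5)) (by simp) (by simp) (by simp) (by norm_num) (by norm_num) (by norm_num) (by norm_num) (by norm_num)

/-- Upper triangular matrix. -/
noncomputable def UT (a b c p q r : Trop) : Matrix (Fin 3) (Fin 3) Trop := !![a, p, r; 0, b, q; 0, 0, c]

lemma UT_mul (a b c p q r a' b' c' p' q' r' : Trop) : UT a b c p q r * UT a' b' c' p' q' r' =
    UT (a * a') (b * b') (c * c') (a * p' + p * b') (b * q' + q * c') (a * r' + p * q' + r * c') := by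
  ext i j
  fin_cases i <;> fin_cases j <;> simp [UT, Matrix.mul_apply, Fin.sum_univ_three]

lemma UT_eq (X : Matrix (Fin 3) (Fin 3) Trop) (hX : ∀ i j : Fin 3, j < i → X i j = 0) :
    X = UT (X 0 0) (X 1 1) (X 2 2) (X 0 1) (X 1 2) (X 0 2) := by
  ext i j
  fin_cases i <;> fin_cases j <;> simp [UT, hX]

lemma M_eq (a b c p q r s t u : Trop) :
    UT a b c s t u * UT a b c p q r * UT a b c p q r * UT a b c s t u * UT a b c s t u * UT a b c p q r =
    UT (a^6) (b^6) (c^6) (s * a^0 * b^5 + p * a^1 * b^4 + p * a^2 * b^3 + s * a^3 * b^2 + s * a^4 * b^1 + p * a^5 * b^0) (t * b^0 * c^5 + q * b^1 * c^4 + q * b^2 * c^3 + t * b^3 * c^2 + t * b^4 * c^1 + q * b^5 * c^0)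
      (u * a^0 * c^5 + r * a^1 * c^4 + r * a^2 * c^3 + u * a^3 * c^2 + u * a^4 * c^1 + r * a^5 * c^0 + s * q * a^0 * b^0 * c^4 + s * q * a^0 * b^1 * c^3 + s * t * a^0 * b^2 * c^2 + s * t * a^0 * b^3 * c^1 + s * q * a^0 * b^4 * c^0 + p * q * a^1 * b^0 * c^3 + p * t * a^1 * b^1 * c^2 + p * t * a^1 * b^2 * c^1 + p * q * a^1 * b^3 * c^0 + p * t * a^2 * b^0 * c^2 + p * t * a^2 * b^1 * c^1 + p * q * a^2 * b^2 * c^0 + s * t * a^3 * b^0 * c^1 + s * q * a^3 * b^1 * c^0 + s * q * a^4 * b^0 * c^0) := by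
  simp only [UT_mul]
  congr 1 <;> ring

lemma e12_x (a c p s : Trop) : let b : Trop := 1
    a^6 * a * (s * a^0 * c^5 + p * a^1 * c^4 + p * a^2 * c^3 + s * a^3 * c^2 + s * a^4 * c^1 + p * a^5 * c^0) + (a^6 * p + (s * a^0 * c^5 + p * a^1 * c^4 + p * a^2 * c^3 + s * a^3 * c^2 + s * a^4 * c^1 + p * a^5 * c^0) * c) * c^6 = p * (poly a b c [(1,0,11), (2,0,10), (5,0,7), (8,0,4), (9,0,3), (12,0,0)]) +
      s * (poly a b c [(0,0,12), (3,0,9), (4,0,8), (7,0,5), (10,0,2), (11,0,1)]) := by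
  intro b
  rw [← d_x a b c]
  simp only [poly, mon, List.map_cons, List.map_nil, List.sum_cons, List.sum_nil]
  simp only [b]
  ring

set_option maxHeartbeats 4000000 in
lemma e13_x (a b c p q r s t u : Trop) :
    a^6 * a * (u * a^0 * c^5 + r * a^1 * c^4 + r * a^2 * c^3 + u * a^3 * c^2 + u * a^4 * c^1 + r * a^5 * c^0 + s * q * a^0 * b^0 * c^4 + s * q * a^0 * b^1 * c^3 + s * t * a^0 * b^2 * c^2 + s * t * a^0 * b^3 * c^1 + s * q * a^0 * b^4 * c^0 + p * q * a^1 * b^0 * c^3 + p * t * a^1 * b^1 * c^2 + p * t * a^1 * b^2 * c^1 + p * q * a^1 * b^3 * c^0 + p * t * a^2 * b^0 * c^2 + p * t * a^2 * b^1 * c^1 + p * q * a^2 * b^2 * c^0 + s * t * a^3 * b^0 * c^1 + s * q * a^3 * b^1 * c^0 + s * q * a^4 * b^0 * c^0) + (a^6 * p + (s * a^0 * b^5 + p * a^1 * b^4 + p * a^2 * b^3 + s * a^3 * b^2 + s * a^4 * b^1 + p * a^5 * b^0) * b) * (t * b^0 * c^5 + q * b^1 * c^4 + q * b^2 * c^3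 + t * b^3 * c^2 + t * b^4 * c^1 + q * b^5 * c^0) +
      (a^6 * r + (s * a^0 * b^5 + p * a^1 * b^4 + p * a^2 * b^3 + s * a^3 * b^2 + s * a^4 * b^1 + p * a^5 * b^0) * q + (u * a^0 * c^5 + r * a^1 * c^4 + r * a^2 * c^3 + u * a^3 * c^2 + u * a^4 * c^1 + r * a^5 * c^0 + s * q * a^0 * b^0 * c^4 + s * q * a^0 * b^1 * c^3 + s * t * a^0 * b^2 * c^2 + s * t * a^0 * b^3 * c^1 + s * q * a^0 * b^4 * c^0 + p * q * a^1 * b^0 * c^3 + p * t * a^1 * b^1 * c^2 + p * t * a^1 * b^2 * c^1 + p * q * a^1 * b^3 * c^0 + p * t * a^2 * b^0 * c^2 + p * t * a^2 * b^1 * c^1 + p * q * a^2 * b^2 * c^0 + s * t * a^3 * b^0 * c^1 + s * q * a^3 * b^1 * c^0 + s * q * a^4 * b^0 * c^0) * c) * c^6 =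
      p * q * (poly a b c [(1,0,10), (1,3,7), (1,6,4), (1,7,3), (1,10,0), (2,2,7), (2,5,4), (2,6,3), (2,9,0), (5,2,4), (5,3,3), (5,6,0), (8,0,3), (8,3,0), (9,2,0)]) +
      p * t * (poly a b c [(1,1,9), (1,2,8), (1,5,5), (1,8,2), (1,9,1), (2,0,9), (2,1,8), (2,4,5), (2,7,2), (2,8,1), (5,1,5), (5,4,2), (5,5,1), (8,1,2), (8,2,1), (9,0,2), (9,1,1)]) +
      s * q * (poly a b c [(0,0,11), (0,1,10), (0,4,7), (0,7,4), (0,8,3), (0,11,0), (3,1,7), (3,4,4), (3,5,3), (3,8,0), (4,0,7), (4,3,4), (4,4,3), (4,7,0), (7,0,4), (7,1,3), (7,4,0), (10,1,0), (11,0,0)]) +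
      s * t * (poly a b c [(0,2,9), (0,3,8), (0,6,5), (0,9,2), (0,10,1), (3,0,8), (3,3,5), (3,6,2), (3,7,1), (4,2,5), (4,5,2), (4,6,1), (7,2,2), (7,3,1), (10,0,1)]) +
      r * (poly a b c [(1,0,11), (2,0,10), (5,0,7), (8,0,4), (9,0,3), (12,0,0)]) +
      u * (poly a b c [(0,0,12), (3,0,9), (4,0,8), (7,0,5), (10,0,2), (11,0,1)]) := by
  trans p * q * (poly a b c [(1,0,10), (1,3,7), (1,6,4), (1,7,3), (1,10,0), (2,2,7), (2,5,4), (2,6,3), (2,9,0), (5,2,4), (5,3,3), (5,6,0), (8,0,3), (8,3,0), (9,2,0)] + poly a b c [(1,4,6), (2,3,6), (5,0,6), (6,1,4), (6,2,3), (6,5,0)]) +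
      p * t * (poly a b c [(1,1,9), (1,2,8), (1,5,5), (1,8,2), (1,9,1), (2,0,9), (2,1,8), (2,4,5), (2,7,2), (2,8,1), (5,1,5), (5,4,2), (5,5,1), (8,1,2), (8,2,1), (9,0,2), (9,1,1)] + poly a b c [(6,0,5), (6,3,2), (6,4,1)]) +
      s * q * (poly a b c [(0,0,11), (0,1,10), (0,4,7), (0,7,4), (0,8,3), (0,11,0), (3,1,7), (3,4,4), (3,5,3), (3,8,0), (4,0,7), (4,3,4), (4,4,3), (4,7,0), (7,0,4), (7,1,3), (7,4,0), (10,1,0), (11,0,0)] + poly a b c [(0,5,6), (3,2,6), (4,1,6)]) +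
      s * t * (poly a b c [(0,2,9), (0,3,8), (0,6,5), (0,9,2), (0,10,1), (3,0,8), (3,3,5), (3,6,2), (3,7,1), (4,2,5), (4,5,2), (4,6,1), (7,2,2), (7,3,1), (10,0,1)]) +
      r * (poly a b c [(1,0,11), (2,0,10), (5,0,7), (8,0,4), (9,0,3), (12,0,0)] + poly a b c [(6,0,6)]) +
      u * (poly a b c [(0,0,12), (3,0,9), (4,0,8), (7,0,5), (10,0,2), (11,0,1)])
  · simp only [poly, mon, List.map_cons, List.map_nil, List.sum_cons, List.sum_nil]
    ring
  · rw [d_x_xx, d_x_xy, d_x_yx, d_x]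

lemma e12_y (a c p s : Trop) : let b : Trop := 1
    a^6 * a * (s * a^0 * c^5 + p * a^1 * c^4 + p * a^2 * c^3 + s * a^3 * c^2 + s * a^4 * c^1 + p * a^5 * c^0) + (a^6 * s + (s * a^0 * c^5 + p * a^1 * c^4 + p * a^2 * c^3 + s * a^3 * c^2 + s * a^4 * c^1 + p * a^5 * c^0) * c) * c^6 = p * (poly a b c [(1,0,11), (2,0,10), (5,0,7), (8,0,4), (9,0,3), (12,0,0)]) +
      s * (poly a b c [(0,0,12), (3,0,9), (4,0,8), (7,0,5), (10,0,2), (11,0,1)]) := by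
  intro b
  rw [← d_y a b c]
  simp only [poly, mon, List.map_cons, List.map_nil, List.sum_cons, List.sum_nil]
  simp only [b]
  ring

set_option maxHeartbeats 4000000 in
lemma e13_y (a b c p q r s t u : Trop) :
    a^6 * a * (u * a^0 * c^5 + r * a^1 * c^4 + r * a^2 * c^3 + u * a^3 * c^2 + u * a^4 * c^1 + r * a^5 * c^0 + s * q * a^0 * b^0 * c^4 + s * q * a^0 * b^1 * c^3 + s * t * a^0 * b^2 * c^2 + s * t * a^0 * b^3 * c^1 + s * q * a^0 * b^4 * c^0 + p * q * a^1 * b^0 * c^3 + p * t * a^1 * b^1 * c^2 + p * t * a^1 * b^2 * c^1 + p * q * a^1 * b^3 * c^0 + p * t * a^2 * b^0 * c^2 + p * t * a^2 * b^1 * c^1 + p * q * a^2 * b^2 * c^0 + s * t * a^3 * b^0 * c^1 + s * q * a^3 * b^1 * c^0 + s * q * a^4 * b^0 * c^0) + (a^6 * s + (s * a^0 * b^5 + p * a^1 * b^4 + p * a^2 * b^3 + s * a^3 * b^2 + s * a^4 * b^1 + p * a^5 * b^0) * b) * (t * b^0 * c^5 + q * b^1 * c^4 + q * b^2 * c^3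 + t * b^3 * c^2 + t * b^4 * c^1 + q * b^5 * c^0) +
      (a^6 * u + (s * a^0 * b^5 + p * a^1 * b^4 + p * a^2 * b^3 + s * a^3 * b^2 + s * a^4 * b^1 + p * a^5 * b^0) * t + (u * a^0 * c^5 + r * a^1 * c^4 + r * a^2 * c^3 + u * a^3 * c^2 + u * a^4 * c^1 + r * a^5 * c^0 + s * q * a^0 * b^0 * c^4 + s * q * a^0 * b^1 * c^3 + s * t * a^0 * b^2 * c^2 + s * t * a^0 * b^3 * c^1 + s * q * a^0 * b^4 * c^0 + p * q * a^1 * b^0 * c^3 + p * t * a^1 * b^1 * c^2 + p * t * a^1 * b^2 * c^1 + p * q * a^1 * b^3 * c^0 + p * t * a^2 * b^0 * c^2 + p * t * a^2 * b^1 * c^1 + p * q * a^2 * b^2 * c^0 + s * t * a^3 * b^0 * c^1 + s * q * a^3 * b^1 * c^0 + s * q * a^4 * b^0 * c^0) * c) * c^6 =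
      p * q * (poly a b c [(1,0,10), (1,3,7), (1,6,4), (1,7,3), (1,10,0), (2,2,7), (2,5,4), (2,6,3), (2,9,0), (5,2,4), (5,3,3), (5,6,0), (8,0,3), (8,3,0), (9,2,0)]) +
      p * t * (poly a b c [(1,1,9), (1,2,8), (1,5,5), (1,8,2), (1,9,1), (2,0,9), (2,1,8), (2,4,5), (2,7,2), (2,8,1), (5,1,5), (5,4,2), (5,5,1), (8,1,2), (8,2,1), (9,0,2), (9,1,1)]) +
      s * q * (poly a b c [(0,0,11), (0,1,10), (0,4,7), (0,7,4), (0,8,3), (0,11,0), (3,1,7), (3,4,4), (3,5,3), (3,8,0), (4,0,7), (4,3,4), (4,4,3), (4,7,0), (7,0,4), (7,1,3), (7,4,0), (10,1,0), (11,0,0)]) +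
      s * t * (poly a b c [(0,2,9), (0,3,8), (0,6,5), (0,9,2), (0,10,1), (3,0,8), (3,3,5), (3,6,2), (3,7,1), (4,2,5), (4,5,2), (4,6,1), (7,2,2), (7,3,1), (10,0,1)]) +
      r * (poly a b c [(1,0,11), (2,0,10), (5,0,7), (8,0,4), (9,0,3), (12,0,0)]) +
      u * (poly a b c [(0,0,12), (3,0,9), (4,0,8), (7,0,5), (10,0,2), (11,0,1)]) := by
  trans p * q * (poly a b c [(1,0,10), (1,3,7), (1,6,4), (1,7,3), (1,10,0), (2,2,7), (2,5,4), (2,6,3), (2,9,0), (5,2,4), (5,3,3), (5,6,0), (8,0,3), (8,3,0), (9,2,0)]) +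
      p * t * (poly a b c [(1,1,9), (1,2,8), (1,5,5), (1,8,2), (1,9,1), (2,0,9), (2,1,8), (2,4,5), (2,7,2), (2,8,1), (5,1,5), (5,4,2), (5,5,1), (8,1,2), (8,2,1), (9,0,2), (9,1,1)] + poly a b c [(1,4,6), (2,3,6), (5,0,6)]) +
      s * q * (poly a b c [(0,0,11), (0,1,10), (0,4,7), (0,7,4), (0,8,3), (0,11,0), (3,1,7), (3,4,4), (3,5,3), (3,8,0), (4,0,7), (4,3,4), (4,4,3), (4,7,0), (7,0,4), (7,1,3), (7,4,0), (10,1,0), (11,0,0)] + poly a b c [(6,1,4), (6,2,3), (6,5,0)]) +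
      s * t * (poly a b c [(0,2,9), (0,3,8), (0,6,5), (0,9,2), (0,10,1), (3,0,8), (3,3,5), (3,6,2), (3,7,1), (4,2,5), (4,5,2), (4,6,1), (7,2,2), (7,3,1), (10,0,1)] + poly a b c [(0,5,6), (3,2,6), (4,1,6), (6,0,5), (6,3,2), (6,4,1)]) +
      r * (poly a b c [(1,0,11), (2,0,10), (5,0,7), (8,0,4), (9,0,3), (12,0,0)]) +
      u * (poly a b c [(0,0,12), (3,0,9), (4,0,8), (7,0,5), (10,0,2), (11,0,1)] + poly a b c [(6,0,6)])
  · simp only [poly, mon, List.map_cons, List.map_nil, List.sum_cons, List.sum_nil]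
    ring
  · rw [d_y_xy, d_y_yx, d_y_yy, d_y]

/-- diagonally equivalent upper triangular `3 × 3` tropical matrices `X`, `Y`
satisfy `M·X·M = M·Y·M` where `M = YX²Y²X`. -/
theorem three_by_three_diag_equiv_identity (X Y : Matrix (Fin 3) (Fin 3) Trop)
    (hX : ∀ i j : Fin 3, j < i → X i j = 0)
    (hY : ∀ i j : Fin 3, j < i → Y i j = 0)
    (hdiag : ∀ i : Fin 3, X i i = Y i i) :
    (Y * X * X * Y * Y * X) * X * (Y * X * X * Y * Y * X) =
      (Y * X * X * Y * Y * X) * Y * (Y * X * X * Y * Y * X) := by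
  obtain ⟨a, b, c, p, q, r, s, t, u, rfl, rfl⟩ : ∃ a b c p q r s t u,
      X = UT a b c p q r ∧ Y = UT a b c s t u := by
    refine ⟨X 0 0, X 1 1, X 2 2, X 0 1, X 1 2, X 0 2, Y 0 1, Y 1 2, Y 0 2, UT_eq X hX, ?_⟩
    rw [hdiag 0, hdiag 1, hdiag 2]
    exact UT_eq Y hY
  rw [M_eq]
  simp only [UT_mul]
  congr 1
  · exact (e12_x a b p s).trans (e12_y a b p s).symm
  · exact (e12_x b c q t).trans (e12_y b c q t).symm
  · exact (e13_x a b c p q r s t u).trans (e13_y a b c p q r s t u).symm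
end

section
/- Any two 3×3 upper triangular tropical matrices A and B satisfy the semigroup identity obtained from yx²y²x·x·yx²y²x = yx²y²x·y·yx²y²x by substituting x = A·B and y = B·A: setting X = A·B, Y = B·A and M = Y·X·X·Y·Y·X, one has M·X·M = M·Y·M. -/
theorem t_add_eq_min (a b : Trop) : a + b = min a b := by
  rcases le_total a b with h | h
  · rw [Tropical.add_eq_left h, min_eq_left h]
  · rw [Tropical.add_eq_right h, min_eq_right h]

theorem t_le_add {a b c : Trop} : c ≤ a + b ↔ c ≤ a ∧ c ≤ b := by
  rw [t_add_eq_min]; exact le_min_iff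

theorem t_add_le_left (a b : Trop) : a + b ≤ a := by
  rw [t_add_eq_min]; exact min_le_left _ _

theorem t_add_le_right (a b : Trop) : a + b ≤ b := by
  rw [t_add_eq_min]; exact min_le_right _ _

theorem t_mul_le {a b c d : Trop} (h : a ≤ b) (h' : c ≤ d) : a * c ≤ b * d :=
  mul_le_mul' h h'

theorem t_pow_le {a b : Trop} (h : a ≤ b) (n : ℕ) : a ^ n ≤ b ^ n :=
  pow_le_pow_left' h n

theorem core1 (p q r s t m12 m23 m13 : Trop) (a a2 i i2 a' c e k k2 : ℕ)
    (ha : a + a2 = 5) (hi : i + i2 = 5) (hb : a' + c + 1 + e = 5) (hib : i ≤ a' + c + 1)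
    (hk : k + k2 = 4)
    (h12 : m12 ≤ s * p ^ a * q ^ a2)
    (h23 : m23 ≤ t * q ^ i * r ^ i2)
    (h13 : m13 ≤ s * t * p ^ a' * q ^ c * r ^ e)
    (h13' : m13 ≤ s * t * p ^ k * r ^ k2) :
    m13 * p ^ 7 + m12 * q * m23 + m13 * r ^ 7 ≤ s * p ^ 6 * (t * q ^ i * r ^ i2) := by
  rcases le_total q p with hqp | hpq
  · refine (t_add_le_left _ _).trans ((t_add_le_right _ _).trans ?_)
    have e6 : p ^ 6 = p ^ a * p ^ (a2 + 1) := by rw [← pow_add]; congr 1; omega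
    calc m12 * q * m23 ≤ (s * p ^ a * q ^ a2) * q * (t * q ^ i * r ^ i2) :=
          t_mul_le (t_mul_le h12 le_rfl) h23
      _ = (s * p ^ a * q ^ (a2 + 1)) * (t * q ^ i * r ^ i2) := by ring
      _ ≤ (s * p ^ a * p ^ (a2 + 1)) * (t * q ^ i * r ^ i2) :=
          t_mul_le (t_mul_le le_rfl (t_pow_le hqp _)) le_rfl
      _ = _ := by rw [e6]; ring
  · rcases le_total q r with hqr | hrq
    · refine (t_add_le_left _ _).trans ((t_add_le_left _ _).trans ?_)
      obtain ⟨f, hf⟩ := Nat.exists_eq_add_of_le hib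
      have hi2 : i2 = f + e := by omega
      calc m13 * p ^ 7 ≤ (s * t * p ^ a' * q ^ c * r ^ e) * p ^ 7 := t_mul_le h13 le_rfl
        _ = (s * p ^ 6) * t * r ^ e * q ^ c * p ^ (a' + 1) := by ring
        _ ≤ (s * p ^ 6) * t * r ^ e * q ^ c * q ^ (a' + 1) :=
            t_mul_le le_rfl (t_pow_le hpq _)
        _ = (s * p ^ 6) * t * r ^ e * q ^ (a' + c + 1) := by ring
        _ = (s * p ^ 6) * t * r ^ e * q ^ i * q ^ f := by rw [hf]; ring
        _ ≤ (s * p ^ 6) * t * r ^ e * q ^ i * r ^ f := t_mul_le le_rfl (t_pow_le hqr _)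
        _ = _ := by rw [hi2]; ring
    · have key : s * t * p ^ 6 * r ^ 5 ≤ s * p ^ 6 * (t * q ^ i * r ^ i2) := by
        calc s * t * p ^ 6 * r ^ 5 = s * t * p ^ 6 * r ^ i2 * r ^ i := by rw [← hi]; ring
          _ ≤ s * t * p ^ 6 * r ^ i2 * q ^ i := t_mul_le le_rfl (t_pow_le hrq _)
          _ = _ := by ring
      refine le_trans ?_ key
      rcases le_total p r with hpr | hrp
      · refine (t_add_le_left _ _).trans ((t_add_le_left _ _).trans ?_)
        have e5 : r ^ 5 = r ^ k2 * r ^ (k + 1) := by rw [← pow_add]; congr 1; omega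
        calc m13 * p ^ 7 ≤ (s * t * p ^ k * r ^ k2) * p ^ 7 := t_mul_le h13' le_rfl
          _ = s * t * p ^ 6 * r ^ k2 * p ^ (k + 1) := by ring
          _ ≤ s * t * p ^ 6 * r ^ k2 * r ^ (k + 1) := t_mul_le le_rfl (t_pow_le hpr _)
          _ = _ := by rw [e5]; ring
      · refine (t_add_le_right _ _).trans ?_
        have e6 : p ^ 6 = p ^ k * p ^ (k2 + 2) := by rw [← pow_add]; congr 1; omega
        calc m13 * r ^ 7 ≤ (s * t * p ^ k * r ^ k2) * r ^ 7 := t_mul_le h13' le_rfl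
          _ = s * t * p ^ k * r ^ 5 * r ^ (k2 + 2) := by ring
          _ ≤ s * t * p ^ k * r ^ 5 * p ^ (k2 + 2) := t_mul_le le_rfl (t_pow_le hrp _)
          _ = _ := by rw [e6]; ring

theorem core2 (p q s m : Trop) (h1 : m ≤ s * p * q ^ 4) (h5 : m ≤ s * p ^ 5) :
    m * p ^ 7 + m * q ^ 7 ≤ s * p ^ 6 * q ^ 6 := by
  rcases le_total p q with h | h
  · refine (t_add_le_left _ _).trans ?_
    calc m * p ^ 7 ≤ (s * p ^ 5) * p ^ 7 := t_mul_le h5 le_rfl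
      _ = s * p ^ 6 * p ^ 6 := by ring
      _ ≤ _ := t_mul_le le_rfl (t_pow_le h _)
  · refine (t_add_le_right _ _).trans ?_
    calc m * q ^ 7 ≤ (s * p * q ^ 4) * q ^ 7 := t_mul_le h1 le_rfl
      _ = s * p * q ^ 6 * q ^ 5 := by ring
      _ ≤ s * p * q ^ 6 * p ^ 5 := t_mul_le le_rfl (t_pow_le h _)
      _ = _ := by ring

/-- Same with the roles of the two letters in the word exchanged. -/
theorem core2' (p q s m : Trop) (h1 : m ≤ s * q ^ 5) (h5 : m ≤ s * p ^ 4 * q) :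
    m * p ^ 7 + m * q ^ 7 ≤ s * p ^ 6 * q ^ 6 := by
  have := core2 q p s m (h5.trans (le_of_eq (by ring))) h1
  rw [add_comm] at this
  exact this.trans (le_of_eq (by ring))

/-- Upper triangular with entries. -/
abbrev ut (p q r u v w : Trop) : Matrix (Fin 3) (Fin 3) Trop :=
  !![p, u, w; 0, q, v; 0, 0, r]

theorem ut_mul (p q r u v w p' q' r' u' v' w' : Trop) :
    ut p q r u v w * ut p' q' r' u' v' w' =
      ut (p * p') (q * q') (r * r') (p * u' + u * q') (q * v' + v * r')
        (p * w' + u * v' + w * r') := by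
  ext i j
  fin_cases i <;> fin_cases j <;> simp [Matrix.mul_apply, Fin.sum_univ_three]

theorem mul_entry_le (P Q : Matrix (Fin 3) (Fin 3) Trop) (i j k : Fin 3) {c d : Trop}
    (h : P i k ≤ c) (h' : Q k j ≤ d) : (P * Q) i j ≤ c * d := by
  refine le_trans ?_ (t_mul_le h h')
  rw [Matrix.mul_apply, Fin.sum_univ_three]
  fin_cases k
  · exact (t_add_le_left _ _).trans (t_add_le_left _ _)
  · exact (t_add_le_left _ _).trans (t_add_le_right _ _)
  · exact t_add_le_right _ _

theorem path_le (P1 P2 P3 P4 P5 P6 : Matrix (Fin 3) (Fin 3) Trop)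
    (i k1 k2 k3 k4 k5 j : Fin 3) :
    (P1 * P2 * P3 * P4 * P5 * P6) i j ≤
      P1 i k1 * P2 k1 k2 * P3 k2 k3 * P4 k3 k4 * P5 k4 k5 * P6 k5 j :=
  mul_entry_le _ _ _ _ k5 (mul_entry_le _ _ _ _ k4 (mul_entry_le _ _ _ _ k3
    (mul_entry_le _ _ _ _ k2 (mul_entry_le _ _ _ _ k1 le_rfl le_rfl) le_rfl) le_rfl) le_rfl)
    le_rfl

/-- The common matrix `S` absorbs the middle terms. -/
theorem absorb_eq (p q r m12 m23 m13 u v w S12 S23 S13 : Trop)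
    (e12 : S12 = m12 * p ^ 7 + m12 * q ^ 7) (e23 : S23 = m23 * q ^ 7 + m23 * r ^ 7)
    (e13 : S13 = m13 * p ^ 7 + m12 * q * m23 + m13 * r ^ 7)
    (h12 : S12 ≤ u * p ^ 6 * q ^ 6) (h23 : S23 ≤ v * q ^ 6 * r ^ 6)
    (h13 : S13 ≤ w * p ^ 6 * r ^ 6) (h13u : S13 ≤ u * p ^ 6 * m23)
    (h13v : S13 ≤ v * r ^ 6 * m12) :
    ut (p ^ 6) (q ^ 6) (r ^ 6) m12 m23 m13 * ut p q r u v w *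
      ut (p ^ 6) (q ^ 6) (r ^ 6) m12 m23 m13 =
    ut (p ^ 13) (q ^ 13) (r ^ 13) S12 S23 S13 := by
  have f1 : p ^ 6 * p * p ^ 6 = p ^ 13 := by ring
  have f2 : q ^ 6 * q * q ^ 6 = q ^ 13 := by ring
  have f3 : r ^ 6 * r * r ^ 6 = r ^ 13 := by ring
  have f4 : p ^ 6 * p * m12 + (p ^ 6 * u + m12 * q) * q ^ 6 = S12 := by
    rw [← Tropical.add_eq_left h12, e12]; ring
  have f5 : q ^ 6 * q * m23 + (q ^ 6 * v + m23 * r) * r ^ 6 = S23 := by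
    rw [← Tropical.add_eq_left h23, e23]; ring
  have f6 : p ^ 6 * p * m13 + (p ^ 6 * u + m12 * q) * m23 +
      (p ^ 6 * w + m12 * v + m13 * r) * r ^ 6 = S13 := by
    rw [← Tropical.add_eq_left (t_le_add.2 ⟨h13, t_le_add.2 ⟨h13u, h13v⟩⟩), e13]; ring
  rw [ut_mul, ut_mul, f1, f2, f3, f4, f5, f6]

theorem ut_word (p q r x12 x23 x13 y12 y23 y13 : Trop)
    (X Y M : Matrix (Fin 3) (Fin 3) Trop) (hX : X = ut p q r x12 x23 x13)
    (hY : Y = ut p q r y12 y23 y13) (hM : M = Y * X * X * Y * Y * X) :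
    M * X * M = M * Y * M := by
  have h12_0 : M 0 1 ≤ y12 * p ^ 0 * q ^ 5 := by
    rw [hM]
    refine (path_le Y X X Y Y X 0 1 1 1 1 1 1).trans (le_of_eq ?_)
    simp [hX, hY]; try ring
  have h12_1 : M 0 1 ≤ x12 * p ^ 1 * q ^ 4 := by
    rw [hM]
    refine (path_le Y X X Y Y X 0 0 1 1 1 1 1).trans (le_of_eq ?_)
    simp [hX, hY]; try ring
  have h12_2 : M 0 1 ≤ x12 * p ^ 2 * q ^ 3 := by
    rw [hM]
    refine (path_le Y X X Y Y X 0 0 0 1 1 1 1).trans (le_of_eq ?_)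
    simp [hX, hY]; try ring
  have h12_3 : M 0 1 ≤ y12 * p ^ 3 * q ^ 2 := by
    rw [hM]
    refine (path_le Y X X Y Y X 0 0 0 0 1 1 1).trans (le_of_eq ?_)
    simp [hX, hY]; try ring
  have h12_4 : M 0 1 ≤ y12 * p ^ 4 * q ^ 1 := by
    rw [hM]
    refine (path_le Y X X Y Y X 0 0 0 0 0 1 1).trans (le_of_eq ?_)
    simp [hX, hY]; try ring
  have h12_5 : M 0 1 ≤ x12 * p ^ 5 * q ^ 0 := by
    rw [hM]
    refine (path_le Y X X Y Y X 0 0 0 0 0 0 1).trans (le_of_eq ?_)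
    simp [hX, hY]; try ring
  have h23_0 : M 1 2 ≤ y23 * q ^ 0 * r ^ 5 := by
    rw [hM]
    refine (path_le Y X X Y Y X 1 2 2 2 2 2 2).trans (le_of_eq ?_)
    simp [hX, hY]; try ring
  have h23_1 : M 1 2 ≤ x23 * q ^ 1 * r ^ 4 := by
    rw [hM]
    refine (path_le Y X X Y Y X 1 1 2 2 2 2 2).trans (le_of_eq ?_)
    simp [hX, hY]; try ring
  have h23_2 : M 1 2 ≤ x23 * q ^ 2 * r ^ 3 := by
    rw [hM]
    refine (path_le Y X X Y Y X 1 1 1 2 2 2 2).trans (le_of_eq ?_)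
    simp [hX, hY]; try ring
  have h23_3 : M 1 2 ≤ y23 * q ^ 3 * r ^ 2 := by
    rw [hM]
    refine (path_le Y X X Y Y X 1 1 1 1 2 2 2).trans (le_of_eq ?_)
    simp [hX, hY]; try ring
  have h23_4 : M 1 2 ≤ y23 * q ^ 4 * r ^ 1 := by
    rw [hM]
    refine (path_le Y X X Y Y X 1 1 1 1 1 2 2).trans (le_of_eq ?_)
    simp [hX, hY]; try ring
  have h23_5 : M 1 2 ≤ x23 * q ^ 5 * r ^ 0 := by
    rw [hM]
    refine (path_le Y X X Y Y X 1 1 1 1 1 1 2).trans (le_of_eq ?_)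
    simp [hX, hY]; try ring
  have h13_1 : M 0 2 ≤ x13 * p ^ 1 * r ^ 4 := by
    rw [hM]
    refine (path_le Y X X Y Y X 0 0 2 2 2 2 2).trans (le_of_eq ?_)
    simp [hX, hY]; try ring
  have h13_5 : M 0 2 ≤ x13 * p ^ 5 * r ^ 0 := by
    rw [hM]
    refine (path_le Y X X Y Y X 0 0 0 0 0 0 2).trans (le_of_eq ?_)
    simp [hX, hY]; try ring
  have h13_0 : M 0 2 ≤ y13 * p ^ 0 * r ^ 5 := by
    rw [hM]
    refine (path_le Y X X Y Y X 0 2 2 2 2 2 2).trans (le_of_eq ?_)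
    simp [hX, hY]; try ring
  have h13_4 : M 0 2 ≤ y13 * p ^ 4 * r ^ 1 := by
    rw [hM]
    refine (path_le Y X X Y Y X 0 0 0 0 0 2 2).trans (le_of_eq ?_)
    simp [hX, hY]; try ring
  have g01 : M 0 2 ≤ y12 * x23 * p ^ 0 * q ^ 0 * r ^ 4 := by
    rw [hM]
    refine (path_le Y X X Y Y X 0 1 2 2 2 2 2).trans (le_of_eq ?_)
    simp [hX, hY]; try ring
  have g12 : M 0 2 ≤ x12 * x23 * p ^ 1 * q ^ 0 * r ^ 3 := by
    rw [hM]
    refine (path_le Y X X Y Y X 0 0 1 2 2 2 2).trans (le_of_eq ?_)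
    simp [hX, hY]; try ring
  have g23 : M 0 2 ≤ x12 * y23 * p ^ 2 * q ^ 0 * r ^ 2 := by
    rw [hM]
    refine (path_le Y X X Y Y X 0 0 0 1 2 2 2).trans (le_of_eq ?_)
    simp [hX, hY]; try ring
  have g34 : M 0 2 ≤ y12 * y23 * p ^ 3 * q ^ 0 * r ^ 1 := by
    rw [hM]
    refine (path_le Y X X Y Y X 0 0 0 0 1 2 2).trans (le_of_eq ?_)
    simp [hX, hY]; try ring
  have g25 : M 0 2 ≤ x12 * x23 * p ^ 2 * q ^ 2 * r ^ 0 := by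
    rw [hM]
    refine (path_le Y X X Y Y X 0 0 0 1 1 1 2).trans (le_of_eq ?_)
    simp [hX, hY]; try ring
  have g45 : M 0 2 ≤ y12 * x23 * p ^ 4 * q ^ 0 * r ^ 0 := by
    rw [hM]
    refine (path_le Y X X Y Y X 0 0 0 0 0 1 2).trans (le_of_eq ?_)
    simp [hX, hY]; try ring
  have g24 : M 0 2 ≤ x12 * y23 * p ^ 2 * q ^ 1 * r ^ 1 := by
    rw [hM]
    refine (path_le Y X X Y Y X 0 0 0 1 1 2 2).trans (le_of_eq ?_)
    simp [hX, hY]; try ring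
  have g13 : M 0 2 ≤ x12 * y23 * p ^ 1 * q ^ 1 * r ^ 2 := by
    rw [hM]
    refine (path_le Y X X Y Y X 0 0 1 1 2 2 2).trans (le_of_eq ?_)
    simp [hX, hY]; try ring
  have g03 : M 0 2 ≤ y12 * y23 * p ^ 0 * q ^ 2 * r ^ 2 := by
    rw [hM]
    refine (path_le Y X X Y Y X 0 1 1 1 2 2 2).trans (le_of_eq ?_)
    simp [hX, hY]; try ring
  have hMe : M = ut (p ^ 6) (q ^ 6) (r ^ 6) (M 0 1) (M 1 2) (M 0 2) := by
    rw [hM, hX, hY]; simp only [ut_mul]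
    have e6 : ∀ a : Trop, a * a * a * a * a * a = a ^ 6 := fun a => by ring
    simp [e6]
  have E12 : M 0 1 = y12 * p ^ 0 * q ^ 5 + x12 * p ^ 1 * q ^ 4 + x12 * p ^ 2 * q ^ 3 + y12 * p ^ 3 * q ^ 2 + y12 * p ^ 4 * q ^ 1 + x12 * p ^ 5 * q ^ 0 := by
    rw [hM, hX, hY]; simp only [ut_mul]; simp; ring
  have E23 : M 1 2 = y23 * q ^ 0 * r ^ 5 + x23 * q ^ 1 * r ^ 4 + x23 * q ^ 2 * r ^ 3 + y23 * q ^ 3 * r ^ 2 + y23 * q ^ 4 * r ^ 1 + x23 * q ^ 5 * r ^ 0 := by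
    rw [hM, hX, hY]; simp only [ut_mul]; simp; ring
  have S13le : M 0 2 * p ^ 7 + M 0 1 * q * M 1 2 + M 0 2 * r ^ 7 ≤ M 0 2 * p ^ 7 + M 0 2 * r ^ 7 :=
    t_le_add.2 ⟨(t_add_le_left _ _).trans (t_add_le_left _ _), t_add_le_right _ _⟩
  have A12x : M 0 1 * p ^ 7 + M 0 1 * q ^ 7 ≤ x12 * p ^ 6 * q ^ 6 :=
    core2 _ _ _ _ (h12_1.trans (le_of_eq (by ring))) (h12_5.trans (le_of_eq (by ring)))
  have A23x : M 1 2 * q ^ 7 + M 1 2 * r ^ 7 ≤ x23 * q ^ 6 * r ^ 6 :=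
    core2 _ _ _ _ (h23_1.trans (le_of_eq (by ring))) (h23_5.trans (le_of_eq (by ring)))
  have A13x : M 0 2 * p ^ 7 + M 0 1 * q * M 1 2 + M 0 2 * r ^ 7 ≤ x13 * p ^ 6 * r ^ 6 :=
    S13le.trans (core2 _ _ _ _ (h13_1.trans (le_of_eq (by ring))) (h13_5.trans (le_of_eq (by ring))))
  have Ux : M 0 2 * p ^ 7 + M 0 1 * q * M 1 2 + M 0 2 * r ^ 7 ≤ x12 * p ^ 6 * M 1 2 := by
    conv_rhs => rw [E23]
    simp only [mul_add, t_le_add]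
    refine ⟨⟨⟨⟨⟨?_, ?_⟩, ?_⟩, ?_⟩, ?_⟩, ?_⟩
    · exact core1 p q r x12 y23 (M 0 1) (M 1 2) (M 0 2) 1 4 0 5 2 1 1 2 2 rfl rfl rfl (by norm_num) rfl
        (h12_1.trans (le_of_eq (by ring))) (h23_0.trans (le_of_eq (by ring))) (g24.trans (le_of_eq (by ring))) (g23.trans (le_of_eq (by ring)))
    · exact core1 p q r x12 x23 (M 0 1) (M 1 2) (M 0 2) 1 4 1 4 2 2 0 1 3 rfl rfl rfl (by norm_num) rfl
        (h12_1.trans (le_of_eq (by ring))) (h23_1.trans (le_of_eq (by ring))) (g25.trans (le_of_eq (by ring))) (g12.trans (le_of_eq (by ring)))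
    · exact core1 p q r x12 x23 (M 0 1) (M 1 2) (M 0 2) 1 4 2 3 2 2 0 1 3 rfl rfl rfl (by norm_num) rfl
        (h12_1.trans (le_of_eq (by ring))) (h23_2.trans (le_of_eq (by ring))) (g25.trans (le_of_eq (by ring))) (g12.trans (le_of_eq (by ring)))
    · exact core1 p q r x12 y23 (M 0 1) (M 1 2) (M 0 2) 1 4 3 2 2 1 1 2 2 rfl rfl rfl (by norm_num) rfl
        (h12_1.trans (le_of_eq (by ring))) (h23_3.trans (le_of_eq (by ring))) (g24.trans (le_of_eq (by ring))) (g23.trans (le_of_eq (by ring)))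
    · exact core1 p q r x12 y23 (M 0 1) (M 1 2) (M 0 2) 1 4 4 1 2 1 1 2 2 rfl rfl rfl (by norm_num) rfl
        (h12_1.trans (le_of_eq (by ring))) (h23_4.trans (le_of_eq (by ring))) (g24.trans (le_of_eq (by ring))) (g23.trans (le_of_eq (by ring)))
    · exact core1 p q r x12 x23 (M 0 1) (M 1 2) (M 0 2) 1 4 5 0 2 2 0 1 3 rfl rfl rfl (by norm_num) rfl
        (h12_1.trans (le_of_eq (by ring))) (h23_5.trans (le_of_eq (by ring))) (g25.trans (le_of_eq (by ring))) (g12.trans (le_of_eq (by ring)))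
  have Vx : M 0 2 * p ^ 7 + M 0 1 * q * M 1 2 + M 0 2 * r ^ 7 ≤ x23 * r ^ 6 * M 0 1 := by
    rw [show M 0 2 * p ^ 7 + M 0 1 * q * M 1 2 + M 0 2 * r ^ 7 = M 0 2 * r ^ 7 + M 1 2 * q * M 0 1 + M 0 2 * p ^ 7 by ring]
    conv_rhs => rw [E12]
    simp only [mul_add, t_le_add]
    refine ⟨⟨⟨⟨⟨?_, ?_⟩, ?_⟩, ?_⟩, ?_⟩, ?_⟩
    · exact (core1 r q p x23 y12 (M 1 2) (M 0 1) (M 0 2) 0 5 5 0 4 0 0 4 0 rfl rfl rfl (by norm_num) rfl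
        (h23_5.trans (le_of_eq (by ring))) (h12_0.trans (le_of_eq (by ring))) (g01.trans (le_of_eq (by ring))) (g01.trans (le_of_eq (by ring)))).trans (le_of_eq (by ring))
    · exact (core1 r q p x23 x12 (M 1 2) (M 0 1) (M 0 2) 0 5 4 1 3 0 1 3 1 rfl rfl rfl (by norm_num) rfl
        (h23_5.trans (le_of_eq (by ring))) (h12_1.trans (le_of_eq (by ring))) (g12.trans (le_of_eq (by ring))) (g12.trans (le_of_eq (by ring)))).trans (le_of_eq (by ring))
    · exact (core1 r q p x23 x12 (M 1 2) (M 0 1) (M 0 2) 0 5 3 2 3 0 1 3 1 rfl rfl rfl (by norm_num) rfl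
        (h23_5.trans (le_of_eq (by ring))) (h12_2.trans (le_of_eq (by ring))) (g12.trans (le_of_eq (by ring))) (g12.trans (le_of_eq (by ring)))).trans (le_of_eq (by ring))
    · exact (core1 r q p x23 y12 (M 1 2) (M 0 1) (M 0 2) 0 5 2 3 4 0 0 4 0 rfl rfl rfl (by norm_num) rfl
        (h23_5.trans (le_of_eq (by ring))) (h12_3.trans (le_of_eq (by ring))) (g01.trans (le_of_eq (by ring))) (g01.trans (le_of_eq (by ring)))).trans (le_of_eq (by ring))
    · exact (core1 r q p x23 y12 (M 1 2) (M 0 1) (M 0 2) 0 5 1 4 4 0 0 4 0 rfl rfl rfl (by norm_num) rfl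
        (h23_5.trans (le_of_eq (by ring))) (h12_4.trans (le_of_eq (by ring))) (g01.trans (le_of_eq (by ring))) (g01.trans (le_of_eq (by ring)))).trans (le_of_eq (by ring))
    · exact (core1 r q p x23 x12 (M 1 2) (M 0 1) (M 0 2) 0 5 0 5 3 0 1 3 1 rfl rfl rfl (by norm_num) rfl
        (h23_5.trans (le_of_eq (by ring))) (h12_5.trans (le_of_eq (by ring))) (g12.trans (le_of_eq (by ring))) (g12.trans (le_of_eq (by ring)))).trans (le_of_eq (by ring))
  have A12y : M 0 1 * p ^ 7 + M 0 1 * q ^ 7 ≤ y12 * p ^ 6 * q ^ 6 :=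
    core2' _ _ _ _ (h12_0.trans (le_of_eq (by ring))) (h12_4.trans (le_of_eq (by ring)))
  have A23y : M 1 2 * q ^ 7 + M 1 2 * r ^ 7 ≤ y23 * q ^ 6 * r ^ 6 :=
    core2' _ _ _ _ (h23_0.trans (le_of_eq (by ring))) (h23_4.trans (le_of_eq (by ring)))
  have A13y : M 0 2 * p ^ 7 + M 0 1 * q * M 1 2 + M 0 2 * r ^ 7 ≤ y13 * p ^ 6 * r ^ 6 :=
    S13le.trans (core2' _ _ _ _ (h13_0.trans (le_of_eq (by ring))) (h13_4.trans (le_of_eq (by ring))))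
  have Uy : M 0 2 * p ^ 7 + M 0 1 * q * M 1 2 + M 0 2 * r ^ 7 ≤ y12 * p ^ 6 * M 1 2 := by
    conv_rhs => rw [E23]
    simp only [mul_add, t_le_add]
    refine ⟨⟨⟨⟨⟨?_, ?_⟩, ?_⟩, ?_⟩, ?_⟩, ?_⟩
    · exact core1 p q r y12 y23 (M 0 1) (M 1 2) (M 0 2) 0 5 0 5 3 0 1 3 1 rfl rfl rfl (by norm_num) rfl
        (h12_0.trans (le_of_eq (by ring))) (h23_0.trans (le_of_eq (by ring))) (g34.trans (le_of_eq (by ring))) (g34.trans (le_of_eq (by ring)))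
    · exact core1 p q r y12 x23 (M 0 1) (M 1 2) (M 0 2) 0 5 1 4 4 0 0 0 4 rfl rfl rfl (by norm_num) rfl
        (h12_0.trans (le_of_eq (by ring))) (h23_1.trans (le_of_eq (by ring))) (g45.trans (le_of_eq (by ring))) (g01.trans (le_of_eq (by ring)))
    · exact core1 p q r y12 x23 (M 0 1) (M 1 2) (M 0 2) 0 5 2 3 4 0 0 0 4 rfl rfl rfl (by norm_num) rfl
        (h12_0.trans (le_of_eq (by ring))) (h23_2.trans (le_of_eq (by ring))) (g45.trans (le_of_eq (by ring))) (g01.trans (le_of_eq (by ring)))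
    · exact core1 p q r y12 y23 (M 0 1) (M 1 2) (M 0 2) 0 5 3 2 3 0 1 3 1 rfl rfl rfl (by norm_num) rfl
        (h12_0.trans (le_of_eq (by ring))) (h23_3.trans (le_of_eq (by ring))) (g34.trans (le_of_eq (by ring))) (g34.trans (le_of_eq (by ring)))
    · exact core1 p q r y12 y23 (M 0 1) (M 1 2) (M 0 2) 0 5 4 1 3 0 1 3 1 rfl rfl rfl (by norm_num) rfl
        (h12_0.trans (le_of_eq (by ring))) (h23_4.trans (le_of_eq (by ring))) (g34.trans (le_of_eq (by ring))) (g34.trans (le_of_eq (by ring)))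
    · exact core1 p q r y12 x23 (M 0 1) (M 1 2) (M 0 2) 0 5 5 0 4 0 0 0 4 rfl rfl rfl (by norm_num) rfl
        (h12_0.trans (le_of_eq (by ring))) (h23_5.trans (le_of_eq (by ring))) (g45.trans (le_of_eq (by ring))) (g01.trans (le_of_eq (by ring)))
  have Vy : M 0 2 * p ^ 7 + M 0 1 * q * M 1 2 + M 0 2 * r ^ 7 ≤ y23 * r ^ 6 * M 0 1 := by
    rw [show M 0 2 * p ^ 7 + M 0 1 * q * M 1 2 + M 0 2 * r ^ 7 = M 0 2 * r ^ 7 + M 1 2 * q * M 0 1 + M 0 2 * p ^ 7 by ring]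
    conv_rhs => rw [E12]
    simp only [mul_add, t_le_add]
    refine ⟨⟨⟨⟨⟨?_, ?_⟩, ?_⟩, ?_⟩, ?_⟩, ?_⟩
    · exact (core1 r q p y23 y12 (M 1 2) (M 0 1) (M 0 2) 1 4 5 0 2 2 0 1 3 rfl rfl rfl (by norm_num) rfl
        (h23_4.trans (le_of_eq (by ring))) (h12_0.trans (le_of_eq (by ring))) (g03.trans (le_of_eq (by ring))) (g34.trans (le_of_eq (by ring)))).trans (le_of_eq (by ring))
    · exact (core1 r q p y23 x12 (M 1 2) (M 0 1) (M 0 2) 1 4 4 1 2 1 1 2 2 rfl rfl rfl (by norm_num) rfl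
        (h23_4.trans (le_of_eq (by ring))) (h12_1.trans (le_of_eq (by ring))) (g13.trans (le_of_eq (by ring))) (g23.trans (le_of_eq (by ring)))).trans (le_of_eq (by ring))
    · exact (core1 r q p y23 x12 (M 1 2) (M 0 1) (M 0 2) 1 4 3 2 2 1 1 2 2 rfl rfl rfl (by norm_num) rfl
        (h23_4.trans (le_of_eq (by ring))) (h12_2.trans (le_of_eq (by ring))) (g13.trans (le_of_eq (by ring))) (g23.trans (le_of_eq (by ring)))).trans (le_of_eq (by ring))
    · exact (core1 r q p y23 y12 (M 1 2) (M 0 1) (M 0 2) 1 4 2 3 2 2 0 1 3 rfl rfl rfl (by norm_num) rfl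
        (h23_4.trans (le_of_eq (by ring))) (h12_3.trans (le_of_eq (by ring))) (g03.trans (le_of_eq (by ring))) (g34.trans (le_of_eq (by ring)))).trans (le_of_eq (by ring))
    · exact (core1 r q p y23 y12 (M 1 2) (M 0 1) (M 0 2) 1 4 1 4 2 2 0 1 3 rfl rfl rfl (by norm_num) rfl
        (h23_4.trans (le_of_eq (by ring))) (h12_4.trans (le_of_eq (by ring))) (g03.trans (le_of_eq (by ring))) (g34.trans (le_of_eq (by ring)))).trans (le_of_eq (by ring))
    · exact (core1 r q p y23 x12 (M 1 2) (M 0 1) (M 0 2) 1 4 0 5 2 1 1 2 2 rfl rfl rfl (by norm_num) rfl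
        (h23_4.trans (le_of_eq (by ring))) (h12_5.trans (le_of_eq (by ring))) (g13.trans (le_of_eq (by ring))) (g23.trans (le_of_eq (by ring)))).trans (le_of_eq (by ring))
  rw [hMe, hX, hY,
    absorb_eq p q r _ _ _ x12 x23 x13 _ _ _ rfl rfl rfl A12x A23x A13x Ux Vx,
    absorb_eq p q r _ _ _ y12 y23 y13 _ _ _ rfl rfl rfl A12y A23y A13y Uy Vy]

theorem eq_ut (A : Matrix (Fin 3) (Fin 3) Trop) (hA : ∀ i j : Fin 3, j < i → A i j = 0) :
    A = ut (A 0 0) (A 1 1) (A 2 2) (A 0 1) (A 1 2) (A 0 2) := by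
  ext i j
  fin_cases i <;> fin_cases j <;> simp [hA]

/-- any two upper triangular `3 × 3` tropical matrices `A`, `B` satisfy the
identity `M·X·M = M·Y·M` with `X = AB`, `Y = BA`, `M = YX²Y²X`. -/
theorem three_by_three_triangular_identity (A B : Matrix (Fin 3) (Fin 3) Trop)
    (hA : ∀ i j : Fin 3, j < i → A i j = 0)
    (hB : ∀ i j : Fin 3, j < i → B i j = 0) :
    ((B * A) * (A * B) * (A * B) * (B * A) * (B * A) * (A * B)) * (A * B) *
        ((B * A) * (A * B) * (A * B) * (B * A) * (B * A) * (A * B)) =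
      ((B * A) * (A * B) * (A * B) * (B * A) * (B * A) * (A * B)) * (B * A) *
        ((B * A) * (A * B) * (A * B) * (B * A) * (B * A) * (A * B)) := by
  have hX : A * B = ut (A 0 0 * B 0 0) (A 1 1 * B 1 1) (A 2 2 * B 2 2) ((A * B) 0 1)
      ((A * B) 1 2) ((A * B) 0 2) := by
    rw [eq_ut A hA, eq_ut B hB, ut_mul]; simp
  have hY : B * A = ut (A 0 0 * B 0 0) (A 1 1 * B 1 1) (A 2 2 * B 2 2) ((B * A) 0 1)
      ((B * A) 1 2) ((B * A) 0 2) := by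
    rw [eq_ut A hA, eq_ut B hB, ut_mul]; simp [mul_comm]
  exact ut_word _ _ _ _ _ _ _ _ _ _ _ _ hX hY rfl
end
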